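/- In the Algorithm-1 iteration of a definite multi-context system, if kb^{k+1} = kb^k for some k, then the belief state S^k is an equilibrium of M; moreover every iterate S^j (for all j) is pointwise contained in every equilibrium of M, so the stabilized belief state S^k is the pointwise-⊆-least equilibrium of M, i.e., its grounded equilibrium. -/

import Mathlib

/-- A bridge rule of a definite MCS: a head literal and a finite positive body. -/
structure Rule (n : ℕ) (α : Type*) where
  head : α
  body : Finset (Fin n × α)
deriving DecidableEq

/-- A definite multi-context system: for each context, a monotone semantic
operator and a finite set of bridge rules. -/
structure MCS (n : ℕ) (α : Type*) [DecidableEq α] where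
  ACC : Fin n → Finset α → Finset α
  mono : ∀ i, Monotone (ACC i)
  br : Fin n → Finset (Rule n α)

variable {n : ℕ} {α : Type*} [DecidableEq α]

/-- A bridge rule is satisfied in a belief state `S` iff every body literal holds. -/
def Satisfied (r : Rule n α) (S : Fin n → Finset α) : Prop :=
  ∀ cp ∈ r.body, cp.2 ∈ S cp.1

instance (r : Rule n α) (S : Fin n → Finset α) : Decidable (Satisfied r S) := by
  unfold Satisfied; infer_instance

/-- The knowledge base induced at context `i` by belief state `S`:
the heads of the bridge rules of context `i` satisfied in `S`. -/
def kbOf (M : MCS n α) (S : Fin n → Finset α) (i : Fin n) : Finset α :=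
  ((M.br i).filter (fun r => Satisfied r S)).image Rule.head

/-- A belief state is an equilibrium iff each belief set is the result of
applying the semantic operator to the induced knowledge base. -/
def IsEquilibrium (M : MCS n α) (S : Fin n → Finset α) : Prop :=
  ∀ i, S i = M.ACC i (kbOf M S i)

/-- Algorithm-1 iteration: the knowledge-base tuples `kb^k`. -/
def kbIter (M : MCS n α) : ℕ → Fin n → Finset α
  | 0 => fun _ => ∅
  | k + 1 => fun i =>
      kbIter M k i ∪
        ((M.br i).filter (fun r =>
            Satisfied r (fun j => M.ACC j (kbIter M k j)))).image Rule.head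

/-- Algorithm-1 iteration: the belief states `S^k`. -/
def SIter (M : MCS n α) (k : ℕ) (i : Fin n) : Finset α :=
  M.ACC i (kbIter M k i)

theorem kbOf_mono (M : MCS n α) {S T : Fin n → Finset α} (hST : ∀ i, S i ⊆ T i) (i : Fin n) :
    kbOf M S i ⊆ kbOf M T i :=
  Finset.image_subset_image
    (Finset.monotone_filter_right _ fun _ _ h cp hcp => hST cp.1 (h cp hcp))

theorem kbIter_succ (M : MCS n α) (k : ℕ) (i : Fin n) :
    kbIter M (k + 1) i = kbIter M k i ∪ kbOf M (SIter M k) i :=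
  rfl

theorem SIter_subset_succ (M : MCS n α) (k : ℕ) (i : Fin n) :
    SIter M k i ⊆ SIter M (k + 1) i :=
  M.mono i (by rw [kbIter_succ]; exact Finset.subset_union_left)

theorem kbIter_subset_kbOf_SIter (M : MCS n α) (k : ℕ) (i : Fin n) :
    kbIter M k i ⊆ kbOf M (SIter M k) i := by
  induction k with
  | zero => exact Finset.empty_subset _
  | succ k ih =>
    rw [kbIter_succ, Finset.union_eq_right.mpr ih]
    exact kbOf_mono M (SIter_subset_succ M k) i

theorem kbIter_subset_kbOf_of_isEquilibrium (M : MCS n α) {E : Fin n → Finset α}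
    (hE : IsEquilibrium M E) (k : ℕ) (i : Fin n) : kbIter M k i ⊆ kbOf M E i := by
  induction k generalizing i with
  | zero => exact Finset.empty_subset _
  | succ k ih =>
    rw [kbIter_succ]
    refine Finset.union_subset (ih i) (kbOf_mono M (fun j => ?_) i)
    rw [hE j]
    exact M.mono j (ih j)

theorem SIter_subset_of_isEquilibrium (M : MCS n α) {E : Fin n → Finset α}
    (hE : IsEquilibrium M E) (k : ℕ) (i : Fin n) : SIter M k i ⊆ E i := by
  rw [hE i]
  exact M.mono i (kbIter_subset_kbOf_of_isEquilibrium M hE k i)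

/-- if the Algorithm-1 iteration stabilizes at step `k`, then `S^k`
is an equilibrium of `M`; moreover every iterate `S^j` is pointwise contained in
every equilibrium of `M`, so `S^k` is the pointwise-⊆-least (grounded) equilibrium. -/
theorem algorithm1_computes_grounded_equilibrium (M : MCS n α) (k : ℕ)
    (hstab : kbIter M (k + 1) = kbIter M k) :
    IsEquilibrium M (SIter M k) ∧
    (∀ (j : ℕ) (E : Fin n → Finset α), IsEquilibrium M E → ∀ i, SIter M j i ⊆ E i) ∧
    (∀ E : Fin n → Finset α, IsEquilibrium M E → ∀ i, SIter M k i ⊆ E i) := by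
  refine ⟨fun i => congrArg (M.ACC i) ?_,
    fun j E hE => SIter_subset_of_isEquilibrium M hE j,
    fun E hE => SIter_subset_of_isEquilibrium M hE k⟩
  have h := congrFun hstab i
  rw [kbIter_succ, Finset.union_eq_left] at h
  exact (kbIter_subset_kbOf_SIter M k i).antisymm h
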